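/- Fix γ ∈ [0,2], t ∈ [0,1) and x*,y* ∈ ℝ. Set d := 0 if y* ≥ x*, and d := max{r ∈ [0,γ] : −|x*−y*| + r(1−t) ≤ 0} if y* < x*. Then d_abs(c₁^γ, c₂^γ)(t,(x*,y*);(1−d,1)) = 0. -/

import Mathlib

open Set Filter
open scoped ENNReal NNReal Topology

noncomputable section

/-- The modulus derivative of the pair `(c₁,c₂)` at `(t,z)` in the direction `w`. -/
def dAbs {E : Type*} [NormedAddCommGroup E] [NormedSpace ℝ E]
    (c₁ c₂ : ℝ → E → ℝ) (t : ℝ) (x : E) (w : E) : ℝ≥0∞ :=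
  Filter.liminf (fun p : ℝ × E =>
      ENNReal.ofReal ((|c₁ (t + p.1) (x + p.1 • p.2) - c₁ t x| +
        |c₂ (t + p.1) (x + p.1 • p.2) - c₂ t x|) / p.1))
    ((𝓝[>] (0 : ℝ)) ×ˢ 𝓝 w)

/-- `c₁^γ(t,(x,y)) = -|x-y|` if `y ≥ x`, and `min{-|x-y| + γ(1-t), 0}` if `y < x`. -/
def c1gamma (γ : ℝ) (t : ℝ) (z : ℝ × ℝ) : ℝ :=
  if z.2 ≥ z.1 then -|z.1 - z.2| else min (-|z.1 - z.2| + γ * (1 - t)) 0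

/-- `c₂^γ(t,(x,y)) = y + (1-t)`. -/
def c2gamma (γ : ℝ) (t : ℝ) (z : ℝ × ℝ) : ℝ := z.2 + (1 - t)

/-- If both functions are constant along the ray in direction `w` for small times, then the modulus
derivative in that direction vanishes. -/
theorem dAbs_eq_zero_of_eventually_eq {E : Type*} [NormedAddCommGroup E] [NormedSpace ℝ E]
    {c₁ c₂ : ℝ → E → ℝ} {t : ℝ} {x w : E}
    (h₁ : ∀ᶠ δ in 𝓝[>] (0 : ℝ), c₁ (t + δ) (x + δ • w) = c₁ t x)
    (h₂ : ∀ᶠ δ in 𝓝[>] (0 : ℝ), c₂ (t + δ) (x + δ • w) = c₂ t x) :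
    dAbs c₁ c₂ t x w = 0 := by
  have hray : Tendsto (fun δ : ℝ => (δ, w)) (𝓝[>] 0) (𝓝[>] 0 ×ˢ 𝓝 w) :=
    tendsto_id.prodMk tendsto_const_nhds
  refine le_antisymm (Filter.liminf_le_of_frequently_le' (hray.frequently ?_)) zero_le
  refine Eventually.frequently ?_
  filter_upwards [h₁, h₂] with δ e₁ e₂
  simp [e₁, e₂]

theorem c2gamma_ray (γ t x y a δ : ℝ) :
    c2gamma γ (t + δ) ((x, y) + δ • (a, 1)) = c2gamma γ t (x, y) := by
  simp only [c2gamma, Prod.snd_add, Prod.smul_snd, smul_eq_mul]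
  ring

theorem c1gamma_ray_of_le {x y : ℝ} (hxy : x ≤ y) (γ t δ : ℝ) :
    c1gamma γ (t + δ) ((x, y) + δ • (1, 1)) = c1gamma γ t (x, y) := by
  simp [c1gamma, hxy]

theorem c1gamma_of_lt {γ t : ℝ} {z : ℝ × ℝ} (hz : z.2 < z.1) :
    c1gamma γ t z = min (z.2 - z.1 + γ * (1 - t)) 0 := by
  rw [c1gamma, if_neg hz.not_ge, abs_of_pos (sub_pos.2 hz), neg_sub]

theorem c1gamma_ray_eventually_eq_of_lt {γ t x y d : ℝ} (hxy : y < x)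
    (hd : IsGreatest {r : ℝ | r ∈ Icc 0 γ ∧ -|x - y| + r * (1 - t) ≤ 0} d) :
    ∀ᶠ δ in 𝓝[>] (0 : ℝ),
      c1gamma γ (t + δ) ((x, y) + δ • (1 - d, 1)) = c1gamma γ t (x, y) := by
  obtain ⟨⟨⟨hd0, hdγ⟩, hd1⟩, hmax⟩ := hd
  rw [abs_of_pos (sub_pos.2 hxy)] at hd1
  have hlt : ∀ᶠ δ in 𝓝[>] (0 : ℝ), y + δ < x + δ * (1 - d) :=
    eventually_nhdsWithin_of_eventually_nhds <|
      ContinuousAt.eventually_lt (by fun_prop) (by fun_prop) (by simpa using hxy)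
  rcases hdγ.eq_or_lt with rfl | hdγ
  · filter_upwards [hlt] with δ hδ
    rw [c1gamma_of_lt (by simpa using hδ), c1gamma_of_lt hxy]
    simp only [Prod.fst_add, Prod.snd_add, Prod.smul_fst, Prod.smul_snd, smul_eq_mul]
    congr 1
    ring
  · have hpos : 0 < y - x + γ * (1 - t) := by
      by_contra! hle
      refine hdγ.not_ge (hmax ⟨⟨hd0.trans hdγ.le, le_rfl⟩, ?_⟩)
      rw [abs_of_pos (sub_pos.2 hxy)]
      linarith
    have hpos' : ∀ᶠ δ in 𝓝[>] (0 : ℝ),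
        0 < y + δ - (x + δ * (1 - d)) + γ * (1 - (t + δ)) :=
      eventually_nhdsWithin_of_eventually_nhds <|
        ContinuousAt.eventually_lt (by fun_prop) (by fun_prop) (by simpa using hpos)
    filter_upwards [hlt, hpos'] with δ hδ hδ'
    rw [c1gamma_of_lt (by simpa using hδ), c1gamma_of_lt hxy, min_eq_right hpos.le,
      min_eq_right (by simpa using hδ'.le)]

/-- For `d = 0` if `y* ≥ x*` and `d = max{r ∈ [0,γ] : -|x*-y*| + r(1-t) ≤ 0}` if `y* < x*`,
one has `d_abs(c₁^γ,c₂^γ)(t,(x*,y*);(1-d,1)) = 0`. -/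
theorem dAbs_c1gamma_c2gamma_eq_zero
    (γ : ℝ) (hγ : γ ∈ Icc (0 : ℝ) 2) (t : ℝ) (htmem : t ∈ Ico (0 : ℝ) 1)
    (xstar ystar : ℝ) (d : ℝ)
    (hd₁ : ystar ≥ xstar → d = 0)
    (hd₂ : ystar < xstar →
      IsGreatest {r : ℝ | r ∈ Icc 0 γ ∧ -|xstar - ystar| + r * (1 - t) ≤ 0} d) :
    dAbs (c1gamma γ) (c2gamma γ) t (xstar, ystar) (1 - d, 1) = 0 := by
  refine dAbs_eq_zero_of_eventually_eq ?_ (.of_forall (c2gamma_ray γ t xstar ystar _))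
  rcases le_or_gt xstar ystar with hxy | hxy
  · rw [hd₁ hxy, sub_zero]
    exact .of_forall (c1gamma_ray_of_le hxy γ t)
  · exact c1gamma_ray_eventually_eq_of_lt hxy (hd₂ hxy)
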